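/- Let (X, ρ, 𝒞) be a semi-Cartan graph with GRS Δ and nil-Hecke algebra 𝒩 over 𝕂 = ℤ[t_1,…,t_θ]. Fix i ≠ j ∈ I and x ∈ X, let m := m^x_{ij} be finite, and for n ∈ ℕ_0 set i_{2n} = j, i_{2n+1} = i, j_{2n} = i, j_{2n+1} = j, x_n := ρ_{i_{n−1}} ⋯ ρ_{i_1}(x) and y_n := ρ_{j_{n−1}} ⋯ ρ_{j_1}(x) (so x_1 = y_1 = x). Then in 𝒩: h_{i_1}^{x_1}(t_{i_1}) h_{i_2}^{x_2}(s_{i_1}^{x_1}·t_{i_2}) ⋯ h_{i_m}^{x_m}(s_{i_1}^{x_1} ⋯ s_{i_{m−1}}·t_{i_m}) = h_{j_1}^{y_1}(t_{j_1}) h_{j_2}^{y_2}(s_{j_1}^{y_1}·t_{j_2}) ⋯ h_{j_m}^{y_m}(s_{j_1}^{y_1} ⋯ s_{j_{m−1}}·t_{j_m}). -/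

import Mathlib

open CategoryTheory

noncomputable section

namespace WeylGroupoid

variable {θ : ℕ} {X : Type} [Fintype X] [DecidableEq X]

/-- A *semi-Cartan graph*: a basic datum `(X, ρ)` together with a compatible bundle of
generalized Cartan matrices. -/
structure SCG (θ : ℕ) (X : Type) [Fintype X] [DecidableEq X] : Type where
  nonempty : Nonempty X
  /-- the involutions `ρ_i` of the basic datum -/
  ρ : Fin θ → X → X
  invol : ∀ i x, ρ i (ρ i x) = x
  /-- the bundle of generalized Cartan matrices `C^x` -/
  C : X → Fin θ → Fin θ → ℤ
  diag : ∀ x i, C x i i = 2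
  offdiag : ∀ x i j, i ≠ j → C x i j ≤ 0
  zero_iff : ∀ x i j, i ≠ j → (C x i j = 0 ↔ C x j i = 0)
  compat : ∀ x i j, C (ρ i x) i j = C x i j

/-- the simple root `α_i ∈ ℤ^θ` -/
def al (θ : ℕ) (i : Fin θ) : Fin θ → ℤ := Pi.single i 1

/-- the reflection `s_i^x` of `ℤ^θ`, `s_i^x (α_j) = α_j - c^x_{ij} α_i` -/
def srefl (G : SCG θ X) (x : X) (i : Fin θ) (v : Fin θ → ℤ) : Fin θ → ℤ :=
  fun k => v k - (if k = i then ∑ j, G.C x i j * v j else 0)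

/-- the cone `ℕ₀ α_i + ℕ₀ α_j` -/
def pairCone (θ : ℕ) (i j : Fin θ) : Set (Fin θ → ℤ) :=
  {v | ∃ a b : ℕ, v = (a : ℤ) • al θ i + (b : ℤ) • al θ j}

/-- A *generalized root system* on a semi-Cartan graph. -/
structure GRS (G : SCG θ X) : Type where
  /-- the root sets `Δ^x` -/
  Δ : X → Set (Fin θ → ℤ)
  pos_neg : ∀ x, Δ x = (Δ x ∩ {v | ∀ k, 0 ≤ v k}) ∪ (-(Δ x ∩ {v | ∀ k, 0 ≤ v k}))
  simple : ∀ x i, Δ x ∩ {v | ∃ c : ℤ, v = c • al θ i} = {al θ i, -al θ i}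
  reflect : ∀ x i, (srefl G x i) '' Δ x = Δ (G.ρ i x)
  pairFinite : ∀ x i j, (Δ x ∩ pairCone θ i j).Finite
  loop : ∀ x i j, (fun y => G.ρ i (G.ρ j y))^[(Δ x ∩ pairCone θ i j).ncard] x = x

variable (G : SCG θ X)

/-- The entries `m^x_{ij} = |Δ^x ∩ (ℕ₀α_i + ℕ₀α_j)|`. -/
def mnum (R : GRS G) (x : X) (i j : Fin θ) : ℕ := (R.Δ x ∩ pairCone θ i j).ncard

/-- the set of positive roots `Δ^x_+` -/
def posRoots (R : GRS G) (x : X) : Set (Fin θ → ℤ) := R.Δ x ∩ {v | ∀ k, 0 ≤ v k}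

/-- The objects of the Weyl groupoid (a type synonym for `X` carrying a quiver
structure depending on `G`). -/
def Obj (G : SCG θ X) : Type := X

instance : Quiver (Obj G) := ⟨fun a b => {i : Fin θ // G.ρ i (show X from b) = (show X from a)}⟩

/-- objects of the path category -/
def pob (x : X) : Paths (Obj G) := (x : X)

/-- the generating arrow `σ_i^x : ρ_i(x) → x` -/
def genArrow (x : X) (i : Fin θ) : pob G (G.ρ i x) ⟶ pob G x :=
  Quiver.Path.nil.cons (⟨i, rfl⟩ : (show Obj G from G.ρ i x) ⟶ (show Obj G from x))

/-- the source of the word `σ_{i_1}^x σ_{i_2} ⋯ σ_{i_m}` (with target `x`) -/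
def wsrc (G : SCG θ X) : List (Fin θ) → X → X
  | [], x => x
  | i :: l, x => wsrc G l (G.ρ i x)

/-- the path `σ_{i_1}^x σ_{i_2} ⋯ σ_{i_m} : wsrc(w,x) → x` in the free category -/
def pathOf (G : SCG θ X) : (w : List (Fin θ)) → (x : X) → (pob G (wsrc G w x) ⟶ pob G x)
  | [], _ => 𝟙 _
  | i :: l, x => (pathOf G l (G.ρ i x)) ≫ genArrow G x i


/-- transport a path along an equality of sources -/
def castSrc {a b c : X} (h : a = b) (f : pob G a ⟶ pob G c) : pob G b ⟶ pob G c := by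
  subst h; exact f

/-- the alternating word `[i, j, i, j, …]` of length `n` -/
def altWord (i j : Fin θ) : ℕ → List (Fin θ)
  | 0 => []
  | n + 1 => i :: altWord j i n

/-- The defining relations `(σ_i^x σ_j)^{m^x_{ij}} = id_x` of the Weyl groupoid. -/
inductive wrel (R : GRS G) : HomRel (Paths (Obj G))
  | rel (x : X) (i j : Fin θ)
      (h : wsrc G (altWord i j (2 * mnum G R x i j)) x = x) :
      wrel R (castSrc G h (pathOf G (altWord i j (2 * mnum G R x i j)) x))
        (𝟙 (pob G x))

variable (R : GRS G)

/-- The Weyl groupoid, as the quotient of the free category on the quiver of the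
`σ_i^x` by the relations `(σ_i^x σ_j)^{m^x_{ij}} = id_x` (every generator is invertible
in this quotient, so it is indeed a groupoid). -/
def W := CategoryTheory.Quotient (wrel G R)

instance : Category (W G R) := inferInstanceAs (Category (CategoryTheory.Quotient (wrel G R)))

/-- objects of the Weyl groupoid -/
def objW (x : X) : W G R := ⟨pob G x⟩

/-- hom-sets `𝒲(y, x)` of the Weyl groupoid -/
def homW (y x : X) := objW G R y ⟶ objW G R x

instance {y x : X} : CoeSort (homW G R y x) (objW G R y ⟶ objW G R x) := ⟨id⟩

/-- the morphism of the Weyl groupoid defined by the word `σ_{i_1}^x ⋯ σ_{i_m}` -/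
def morW (w : List (Fin θ)) (x : X) : homW G R (wsrc G w x) x :=
  (Quotient.functor (wrel G R)).map (pathOf G w x)

/-- the generator `σ_i^x : ρ_i(x) → x` in the Weyl groupoid -/
def genW (x : X) (i : Fin θ) : homW G R (G.ρ i x) x :=
  (Quotient.functor (wrel G R)).map (genArrow G x i)

/-- transport a morphism of the Weyl groupoid along an equality of sources -/
def castW {a b c : X} (h : a = b) (f : homW G R a c) : homW G R b c := by
  subst h; exact f

/-- transport a morphism of the Weyl groupoid along an equality of targets -/
def castTgt {a c c' : X} (h : c = c') (f : homW G R a c) : homW G R a c' := by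
  subst h; exact f

/-- the length `ℓ(f)` of a morphism of the Weyl groupoid -/
def len {y x : X} (f : homW G R y x) : ℕ :=
  sInf {n | ∃ w : List (Fin θ), w.length = n ∧
    ∃ h : wsrc G w x = y, castW G R h (morW G R w x) = f}

/-- `w` is a reduced expression of the morphism `f ∈ 𝒲(y,x)` -/
def IsRedEx (w : List (Fin θ)) {y x : X} (f : homW G R y x) : Prop :=
  ∃ h : wsrc G w x = y, castW G R h (morW G R w x) = f ∧ w.length = len G R f


section NilHecke

variable (𝕂 : Type) [CommRing 𝕂]

/-- the generator `e^x` of the free algebra -/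
def eF (x : X) : FreeAlgebra 𝕂 (X ⊕ X × Fin θ) := FreeAlgebra.ι 𝕂 (Sum.inl x)

/-- the generator `n_i^x` of the free algebra -/
def nF (x : X) (i : Fin θ) : FreeAlgebra 𝕂 (X ⊕ X × Fin θ) := FreeAlgebra.ι 𝕂 (Sum.inr (x, i))

/-- the word `n_{i_1}^x n_{i_2} ⋯ n_{i_m}` in the free algebra
(superscripts determined by composability) -/
def nWF (G : SCG θ X) (𝕂 : Type) [CommRing 𝕂] :
    List (Fin θ) → X → FreeAlgebra 𝕂 (X ⊕ X × Fin θ)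
  | [], _ => 1
  | i :: l, x => nF 𝕂 x i * nWF G 𝕂 l (G.ρ i x)

/-- The defining relations of the nil-Hecke algebra of `(X, ρ, 𝒞)`. -/
inductive nrel (R : GRS G) (𝕂 : Type) [CommRing 𝕂] :
    FreeAlgebra 𝕂 (X ⊕ X × Fin θ) → FreeAlgebra 𝕂 (X ⊕ X × Fin θ) → Prop
  | orth (x y : X) (h : x ≠ y) : nrel R 𝕂 (eF 𝕂 x * eF 𝕂 y) 0
  | idem (x : X) : nrel R 𝕂 (eF 𝕂 x * eF 𝕂 x) (eF 𝕂 x)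
  | total : nrel R 𝕂 (∑ x : X, eF 𝕂 x) 1
  | unit_right (x : X) (i : Fin θ) : nrel R 𝕂 (nF 𝕂 x i * eF 𝕂 (G.ρ i x)) (nF 𝕂 x i)
  | unit_left (x : X) (i : Fin θ) : nrel R 𝕂 (eF 𝕂 x * nF 𝕂 x i) (nF 𝕂 x i)
  | nil (x : X) (i : Fin θ) : nrel R 𝕂 (nF 𝕂 (G.ρ i x) i * nF 𝕂 x i) 0
  | braid (x : X) (i j : Fin θ) (hij : i ≠ j) :
      nrel R 𝕂 (nWF G 𝕂 (altWord i j (mnum G R x i j)) x)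
        (nWF G 𝕂 (altWord j i (mnum G R x i j)) x)

/-- The nil-Hecke algebra `𝒩(X, ρ, 𝒞)` of a Weyl groupoid over `𝕂`. -/
def NH := RingQuot (nrel G R 𝕂)

instance : Ring (NH G R 𝕂) := inferInstanceAs (Ring (RingQuot (nrel G R 𝕂)))
instance : Algebra 𝕂 (NH G R 𝕂) := inferInstanceAs (Algebra 𝕂 (RingQuot (nrel G R 𝕂)))

/-- the generator `e^x` of the nil-Hecke algebra -/
def eN (x : X) : NH G R 𝕂 := RingQuot.mkAlgHom 𝕂 (nrel G R 𝕂) (eF 𝕂 x)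

/-- the generator `n_i^x` of the nil-Hecke algebra -/
def nN (x : X) (i : Fin θ) : NH G R 𝕂 := RingQuot.mkAlgHom 𝕂 (nrel G R 𝕂) (nF 𝕂 x i)

/-- the word `n_{i_1}^x n_{i_2} ⋯ n_{i_m}` in the nil-Hecke algebra -/
def nW (w : List (Fin θ)) (x : X) : NH G R 𝕂 := RingQuot.mkAlgHom 𝕂 (nrel G R 𝕂) (nWF G 𝕂 w x)

/-- the set of morphisms of the Weyl groupoid -/
def Mor := Σ (y : X) (x : X), homW G R y x

/-- the free `𝕂`-module `𝕂𝒲` on the set of morphisms of the Weyl groupoid -/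
abbrev KW := Mor G R →₀ 𝕂

/-- the endomorphism `E^x` of `𝕂𝒲` -/
def Emap (x : X) : KW G R 𝕂 →ₗ[𝕂] KW G R 𝕂 :=
  Finsupp.lift (KW G R 𝕂) 𝕂 (Mor G R)
    (fun m => if m.2.1 = x then Finsupp.single m 1 else 0)

/-- the value of the endomorphism `L_i^x` of `𝕂𝒲` on a basis morphism -/
def Lval (x : X) (i : Fin θ) (m : Mor G R) : KW G R 𝕂 :=
  if h : m.2.1 = G.ρ i x then
    (let f' : homW G R m.1 x := castTgt G R h m.2.2 ≫ genW G R x i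
     if len G R m.2.2 < len G R f' then Finsupp.single ⟨m.1, x, f'⟩ 1 else 0)
  else 0

/-- the endomorphism `L_i^x` of `𝕂𝒲` -/
def Lmap (x : X) (i : Fin θ) : KW G R 𝕂 →ₗ[𝕂] KW G R 𝕂 :=
  Finsupp.lift (KW G R 𝕂) 𝕂 (Mor G R) (Lval G R 𝕂 x i)

end NilHecke

end WeylGroupoid


namespace WeylGroupoid

variable {θ : ℕ} {X : Type} [Fintype X] [DecidableEq X]

/-- The ring automorphism of `𝕂 = ℤ[t_1,…,t_θ]` induced by the reflection `s_i^x`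
(via the identification `α_i ↦ t_i`): `t_j ↦ t_j - c^x_{ij} t_i`. -/
def sAct (G : SCG θ X) (x : X) (i : Fin θ) :
    MvPolynomial (Fin θ) ℤ →+* MvPolynomial (Fin θ) ℤ :=
  (MvPolynomial.aeval fun j => MvPolynomial.X j - MvPolynomial.C (G.C x i j) * MvPolynomial.X i :
    MvPolynomial (Fin θ) ℤ →ₐ[ℤ] MvPolynomial (Fin θ) ℤ).toRingHom

/-- the linear polynomial attached to `v ∈ ℤ^θ` under `α_i ↦ t_i` -/
def lin {θ : ℕ} (v : Fin θ → ℤ) : MvPolynomial (Fin θ) ℤ := ∑ k, MvPolynomial.C (v k) * MvPolynomial.X k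

/-- `h_i^x(t) = e^x + t n_i^x` if `ρ_i(x) = x`, and `h_i^x(t) = t n_i^x` otherwise. -/
def hGen (G : SCG θ X) (R : GRS G) (x : X) (i : Fin θ) (t : MvPolynomial (Fin θ) ℤ) :
    NH G R (MvPolynomial (Fin θ) ℤ) :=
  if G.ρ i x = x then eN G R _ x + t • nN G R _ x i else t • nN G R _ x i

/-- The product `h_{i_1}^{x_1}(s·t_{i_1}) h_{i_2}^{x_2}((s∘s_{i_1}^{x_1})·t_{i_2}) ⋯`;
with `s = id` this is
`h_{i_1}^{x_1}(t_{i_1}) h_{i_2}^{x_2}(s_{i_1}^{x_1}·t_{i_2}) ⋯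
 h_{i_m}^{x_m}(s_{i_1}^{x_1}⋯s_{i_{m-1}}·t_{i_m})`,
where `x_{k+1} = ρ_{i_k}(x_k)`. -/
def hP (G : SCG θ X) (R : GRS G) :
    List (Fin θ) → X → (MvPolynomial (Fin θ) ℤ →+* MvPolynomial (Fin θ) ℤ) →
      NH G R (MvPolynomial (Fin θ) ℤ)
  | [], _, _ => 1
  | i :: l, x, s => hGen G R x i (s (MvPolynomial.X i)) * hP G R l (G.ρ i x) (s.comp (sAct G x i))

/-- the composite ring automorphism `s_{i_1}^{x_1} s_{i_2}^{x_2} ⋯ s_{i_m}^{x_m}` of `𝕂`,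
where `x_{k+1} = ρ_{i_k}(x_k)` -/
def sComp (G : SCG θ X) :
    List (Fin θ) → X → (MvPolynomial (Fin θ) ℤ →+* MvPolynomial (Fin θ) ℤ)
  | [], _ => RingHom.id _
  | i :: l, x => (sAct G x i).comp (sComp G l (G.ρ i x))

end WeylGroupoid

namespace WeylGroupoid

variable {θ : ℕ} {X : Type} [Fintype X] [DecidableEq X]

section Roots

variable (G : SCG θ X) (R : GRS G)

lemma srefl_add (x : X) (i : Fin θ) (v w : Fin θ → ℤ) :
    srefl G x i (v + w) = srefl G x i v + srefl G x i w := by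
  funext k
  simp only [srefl, Pi.add_apply, mul_add, Finset.sum_add_distrib]
  split_ifs <;> ring

lemma srefl_smul (x : X) (i : Fin θ) (c : ℤ) (v : Fin θ → ℤ) :
    srefl G x i (c • v) = c • srefl G x i v := by
  funext k
  simp only [srefl, Pi.smul_apply, smul_eq_mul, mul_sub, mul_ite, mul_zero, Finset.mul_sum,
    mul_left_comm]

lemma srefl_neg (x : X) (i : Fin θ) (v : Fin θ → ℤ) : srefl G x i (-v) = -srefl G x i v := by
  simpa using srefl_smul G x i (-1) v

lemma srefl_al (x : X) (i j : Fin θ) : srefl G x i (al θ j) = al θ j - G.C x i j • al θ i := by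
  funext k
  by_cases h : k = i <;> simp [srefl, al, Pi.single_apply, h]

lemma srefl_al_self (x : X) (i : Fin θ) : srefl G x i (al θ i) = -al θ i := by
  rw [srefl_al, G.diag, two_smul]
  abel

lemma srefl_ρ (x : X) (i : Fin θ) : srefl G (G.ρ i x) i = srefl G x i := by
  funext v k
  simp [srefl, G.compat]

lemma srefl_eq (x : X) (i : Fin θ) (v : Fin θ → ℤ) :
    srefl G x i v = v - (∑ j, G.C x i j * v j) • al θ i := by
  funext k
  by_cases h : k = i <;> simp [srefl, al, h]

lemma srefl_srefl (x : X) (i : Fin θ) (v : Fin θ → ℤ) : srefl G x i (srefl G x i v) = v := by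
  rw [srefl_eq G x i v, sub_eq_add_neg, srefl_add, srefl_neg, srefl_smul, srefl_al_self,
    srefl_eq G x i v]
  simp

lemma srefl_injective (x : X) (i : Fin θ) : Function.Injective (srefl G x i) :=
  Function.LeftInverse.injective (srefl_srefl G x i)

variable {G}

lemma srefl_mem (x : X) (i : Fin θ) {v : Fin θ → ℤ} (hv : v ∈ R.Δ x) :
    srefl G x i v ∈ R.Δ (G.ρ i x) :=
  R.reflect x i ▸ Set.mem_image_of_mem _ hv

lemma nonneg_or_nonpos {x : X} {v : Fin θ → ℤ} (hv : v ∈ R.Δ x) :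
    (∀ k, 0 ≤ v k) ∨ ∀ k, v k ≤ 0 := by
  rw [R.pos_neg x] at hv
  rcases hv with hv | hv
  · exact Or.inl hv.2
  · exact Or.inr fun k => by simpa using hv.2 k

lemma al_mem (x : X) (i : Fin θ) : al θ i ∈ R.Δ x := by
  have h : al θ i ∈ ({al θ i, -al θ i} : Set (Fin θ → ℤ)) := by simp
  rw [← R.simple x i] at h
  exact h.1

lemma eq_al_of_nonneg_smul {x : X} {i : Fin θ} {p : ℕ} (h : (p : ℤ) • al θ i ∈ R.Δ x) :
    (p : ℤ) • al θ i = al θ i := by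
  have h' : (p : ℤ) • al θ i ∈ ({al θ i, -al θ i} : Set (Fin θ → ℤ)) := by
    rw [← R.simple x i]
    exact ⟨h, _, rfl⟩
  rcases h' with h' | h'
  · exact h'
  · have := congrFun h' i
    simp [al] at this

/-- The positive roots at `x` in the plane spanned by `α_i` and `α_j`. -/
def planeRoots (x : X) (i j : Fin θ) : Set (Fin θ → ℤ) := R.Δ x ∩ pairCone θ i j

lemma pairCone_comm (i j : Fin θ) : pairCone θ i j = pairCone θ j i := by
  ext v
  constructor <;> rintro ⟨a, b, rfl⟩ <;> exact ⟨b, a, add_comm _ _⟩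

lemma planeRoots_comm (x : X) (i j : Fin θ) : planeRoots R x i j = planeRoots R x j i := by
  rw [planeRoots, planeRoots, pairCone_comm]

lemma mnum_comm (x : X) (i j : Fin θ) : mnum G R x i j = mnum G R x j i := by
  rw [mnum, mnum, pairCone_comm]

lemma al_mem_planeRoots (x : X) (i j : Fin θ) : al θ i ∈ planeRoots R x i j :=
  ⟨al_mem R x i, 1, 0, by simp⟩

lemma al_mem_planeRoots' (x : X) (i j : Fin θ) : al θ j ∈ planeRoots R x i j :=
  ⟨al_mem R x j, 0, 1, by simp⟩

lemma al_ne {i j : Fin θ} (hij : i ≠ j) : al θ i ≠ al θ j := fun h => by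
  have := congrFun h i
  simp [al, hij] at this

lemma not_nonpos_of_mem_planeRoots {x : X} {i j : Fin θ} {v : Fin θ → ℤ}
    (hv : v ∈ planeRoots R x i j) : ¬ ∀ k, v k ≤ 0 := by
  obtain ⟨hv, p, q, rfl⟩ := hv
  intro h
  have h0 : (p : ℤ) • al θ i + (q : ℤ) • al θ j = ((0 : ℕ) : ℤ) • al θ i := by
    funext k
    refine le_antisymm (by simpa using h k) ?_
    rw [Nat.cast_zero, zero_smul, Pi.zero_apply]
    simp only [Pi.add_apply, Pi.smul_apply, smul_eq_mul, al, Pi.single_apply]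
    positivity
  rw [h0] at hv
  have := congrFun (eq_al_of_nonneg_smul R hv) i
  simp [al] at this

lemma srefl_mem_planeRoots {x : X} {i j : Fin θ} (hij : i ≠ j) {v : Fin θ → ℤ}
    (hv : v ∈ planeRoots R x i j) (hne : v ≠ al θ i) :
    srefl G x i v ∈ planeRoots R (G.ρ i x) i j := by
  obtain ⟨hv, p, q, rfl⟩ := hv
  have hs := srefl_mem R x i hv
  have hq : q ≠ 0 := by
    rintro rfl
    simp only [Nat.cast_zero, zero_smul, add_zero] at hv hne
    exact hne (eq_al_of_nonneg_smul R hv)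
  have he : srefl G x i ((p : ℤ) • al θ i + (q : ℤ) • al θ j) =
      (-(p : ℤ) - q * G.C x i j) • al θ i + (q : ℤ) • al θ j := by
    rw [srefl_add, srefl_smul, srefl_smul, srefl_al_self, srefl_al]
    module
  refine ⟨hs, ?_⟩
  rw [he] at hs ⊢
  have hpos := (nonneg_or_nonpos R hs).resolve_right fun h => by
    have := h j
    simp [al, hij.symm] at this
    omega
  have hi := hpos i
  simp only [al, Pi.add_apply, Pi.smul_apply, Pi.single_eq_same, Pi.single_eq_of_ne hij,
    smul_eq_mul, mul_one, mul_zero, add_zero] at hi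
  exact ⟨(-(p : ℤ) - q * G.C x i j).toNat, q, by rw [Int.toNat_of_nonneg hi]⟩

lemma neg_al_notMem_planeRoots (x : X) (i j : Fin θ) : -al θ i ∉ planeRoots R x i j := fun h =>
  not_nonpos_of_mem_planeRoots R h fun k => by
    by_cases hk : k = i <;> simp [al, hk]

lemma srefl_ne_al {x : X} {i j : Fin θ} {v : Fin θ → ℤ} (hv : v ∈ planeRoots R x i j) :
    srefl G x i v ≠ al θ i := fun h => by
  have := congrArg (srefl G x i) h
  rw [srefl_srefl, srefl_al_self] at this
  exact neg_al_notMem_planeRoots R x i j (this ▸ hv)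

lemma srefl_mem_planeRoots' {x : X} {i j : Fin θ} (hij : i ≠ j) {v : Fin θ → ℤ}
    (hv : v ∈ planeRoots R (G.ρ i x) i j) (hne : v ≠ al θ i) :
    srefl G x i v ∈ planeRoots R x i j := by
  have := srefl_mem_planeRoots R hij hv hne
  rwa [G.invol, srefl_ρ] at this

lemma mnum_ρ (x : X) {i j : Fin θ} (hij : i ≠ j) :
    mnum G R (G.ρ i x) i j = mnum G R x i j := by
  have key : srefl G x i '' (planeRoots R x i j \ {al θ i}) =
      planeRoots R (G.ρ i x) i j \ {al θ i} := by
    ext v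
    constructor
    · rintro ⟨w, ⟨hw, hne⟩, rfl⟩
      exact ⟨srefl_mem_planeRoots R hij hw hne, srefl_ne_al R hw⟩
    · rintro ⟨hv, hne⟩
      refine ⟨srefl G x i v, ⟨srefl_mem_planeRoots' R hij hv hne, ?_⟩, srefl_srefl G x i v⟩
      rw [← srefl_ρ]
      exact srefl_ne_al R hv
  have h := congrArg Set.ncard key
  rw [Set.ncard_image_of_injective _ (srefl_injective G x i)] at h
  have h1 := Set.ncard_sdiff_singleton_add_one (al_mem_planeRoots R x i j) (R.pairFinite x i j)
  have h2 := Set.ncard_sdiff_singleton_add_one (al_mem_planeRoots R (G.ρ i x) i j)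
    (R.pairFinite _ i j)
  change (planeRoots R (G.ρ i x) i j).ncard = (planeRoots R x i j).ncard
  omega

lemma two_le_mnum (x : X) {i j : Fin θ} (hij : i ≠ j) : 2 ≤ mnum G R x i j := by
  rw [← Set.ncard_pair (al_ne hij)]
  refine Set.ncard_le_ncard ?_ (R.pairFinite x i j)
  rintro v (rfl | rfl)
  · exact al_mem_planeRoots R x i j
  · exact al_mem_planeRoots' R x i j

variable (G)

/-- The roots `α_{i_1}, s_{i_1}^{x_1} α_{i_2}, s_{i_1}^{x_1} s_{i_2} α_{i_3}, …` attached to a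
word. -/
def wordRoots : List (Fin θ) → X → List (Fin θ → ℤ)
  | [], _ => []
  | i :: l, x => al θ i :: (wordRoots l (G.ρ i x)).map (srefl G x i)

/-- The inverse of `s_{i_1}^{x_1} ⋯ s_{i_m}^{x_m}`. -/
def invAct : List (Fin θ) → X → (Fin θ → ℤ) → (Fin θ → ℤ)
  | [], _, v => v
  | i :: l, x, v => invAct l (G.ρ i x) (srefl G x i v)

lemma invAct_add (l : List (Fin θ)) (x : X) (v w : Fin θ → ℤ) :
    invAct G l x (v + w) = invAct G l x v + invAct G l x w := by
  induction l generalizing x v w with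
  | nil => rfl
  | cons i l ih => simp only [invAct, srefl_add, ih]

lemma invAct_smul (l : List (Fin θ)) (x : X) (c : ℤ) (v : Fin θ → ℤ) :
    invAct G l x (c • v) = c • invAct G l x v := by
  induction l generalizing x v with
  | nil => rfl
  | cons i l ih => simp only [invAct, srefl_smul, ih]

lemma invAct_neg (l : List (Fin θ)) (x : X) (v : Fin θ → ℤ) :
    invAct G l x (-v) = -invAct G l x v := by
  simpa using invAct_smul G l x (-1) v

lemma invAct_mem (l : List (Fin θ)) (x : X) {v : Fin θ → ℤ} (hv : v ∈ R.Δ x) :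
    invAct G l x v ∈ R.Δ (wsrc G l x) := by
  induction l generalizing x v with
  | nil => exact hv
  | cons i l ih => exact ih _ (srefl_mem R x i hv)

lemma length_wordRoots (l : List (Fin θ)) (x : X) : (wordRoots G l x).length = l.length := by
  induction l generalizing x with
  | nil => rfl
  | cons i l ih => simp [wordRoots, ih]

lemma length_altWord (i j : Fin θ) (n : ℕ) : (altWord i j n).length = n := by
  induction n generalizing i j with
  | zero => rfl
  | succ n ih => simp [altWord, ih]

variable {G}

lemma wordRoots_altWord_eq_planeRoots {i j : Fin θ} {k : ℕ} {x : X}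
    (hsub : ∀ v ∈ wordRoots G (altWord i j k) x, v ∈ planeRoots R x i j)
    (hnodup : (wordRoots G (altWord i j k) x).Nodup)
    (hneg : ∀ v ∈ planeRoots R x i j,
      v ∈ wordRoots G (altWord i j k) x ↔ ∀ r, invAct G (altWord i j k) x v r ≤ 0)
    (hj : al θ j ∈ wordRoots G (altWord i j k) x) : k = mnum G R x i j := by
  have hi : al θ i ∈ wordRoots G (altWord i j k) x := by
    cases k with
    | zero => simp [altWord, wordRoots] at hj
    | succ k => simp [altWord, wordRoots]
  have hi' := (hneg _ (al_mem_planeRoots R x i j)).1 hi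
  have hj' := (hneg _ (al_mem_planeRoots' R x i j)).1 hj
  have hset : planeRoots R x i j = (wordRoots G (altWord i j k) x).toFinset := by
    ext v
    rw [List.coe_toFinset, Set.mem_ofPred_eq]
    refine ⟨fun hv => (hneg v hv).2 fun r => ?_, hsub v⟩
    obtain ⟨-, p, q, rfl⟩ := hv
    rw [invAct_add, invAct_smul, invAct_smul]
    simp only [Pi.add_apply, Pi.smul_apply, smul_eq_mul]
    have h1 := mul_nonneg (Int.natCast_nonneg p) (neg_nonneg.2 (hi' r))
    have h2 := mul_nonneg (Int.natCast_nonneg q) (neg_nonneg.2 (hj' r))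
    linarith
  change k = (planeRoots R x i j).ncard
  rw [hset, Set.ncard_coe_finset, List.toFinset_card_of_nodup hnodup, length_wordRoots,
    length_altWord]

lemma wordRoots_altWord (k : ℕ) : ∀ {i j : Fin θ} (_ : i ≠ j) (x : X) (_ : k ≤ mnum G R x i j),
    (∀ v ∈ wordRoots G (altWord i j k) x, v ∈ planeRoots R x i j) ∧
    (wordRoots G (altWord i j k) x).Nodup ∧
    ∀ v ∈ planeRoots R x i j,
      v ∈ wordRoots G (altWord i j k) x ↔ ∀ r, invAct G (altWord i j k) x v r ≤ 0 := by
  induction k with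
  | zero =>
    intro i j hij x _
    refine ⟨by simp [altWord, wordRoots], by simp [altWord, wordRoots], fun v hv => ?_⟩
    simpa [altWord, wordRoots, invAct] using not_nonpos_of_mem_planeRoots R hv
  | succ k ih =>
    intro i j hij x hk
    have hm : mnum G R (G.ρ i x) j i = mnum G R x i j := by
      rw [mnum_comm, mnum_ρ R x hij]
    obtain ⟨hsub, hnodup, hneg⟩ := ih hij.symm (G.ρ i x) (by omega)
    have hnot : al θ i ∉ wordRoots G (altWord j i k) (G.ρ i x) := fun h => by
      have := wordRoots_altWord_eq_planeRoots R hsub hnodup hneg h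
      omega
    simp only [planeRoots_comm R _ j i] at hsub hneg
    simp only [altWord, wordRoots, invAct]
    refine ⟨?_, ?_, ?_⟩
    · intro v hv
      rcases List.mem_cons.1 hv with rfl | hv
      · exact al_mem_planeRoots R x i j
      · obtain ⟨w, hw, rfl⟩ := List.mem_map.1 hv
        exact srefl_mem_planeRoots' R hij (hsub w hw) fun h => hnot (h ▸ hw)
    · refine List.nodup_cons.2 ⟨fun h => ?_, hnodup.map (srefl_injective G x i)⟩
      obtain ⟨w, hw, h⟩ := List.mem_map.1 h
      rw [← srefl_ρ] at h
      exact srefl_ne_al R (hsub w hw) h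
    · intro v hv
      by_cases hvi : v = al θ i
      · subst hvi
        simp only [List.mem_cons_self, true_iff, srefl_al_self, invAct_neg, Pi.neg_apply,
          neg_nonpos]
        have := mt (hneg _ (al_mem_planeRoots R _ i j)).2 hnot
        exact (nonneg_or_nonpos R (invAct_mem G R _ _ (al_mem R _ i))).resolve_right this
      · rw [← hneg _ (srefl_mem_planeRoots R hij hv hvi), List.mem_cons]
        constructor
        · rintro (h | h)
          · exact absurd h hvi
          · obtain ⟨w, hw, rfl⟩ := List.mem_map.1 h
            rwa [srefl_srefl]
        · exact fun h => Or.inr (List.mem_map.2 ⟨_, h, srefl_srefl G x i v⟩)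

lemma eq_mnum_of_al_mem_wordRoots {i j : Fin θ} (hij : i ≠ j) {x : X} {k : ℕ}
    (hk : k ≤ mnum G R x i j) (hj : al θ j ∈ wordRoots G (altWord i j k) x) :
    k = mnum G R x i j :=
  have h := wordRoots_altWord R k hij x hk
  wordRoots_altWord_eq_planeRoots R h.1 h.2.1 h.2.2 hj

lemma mem_wordRoots_mnum {i j : Fin θ} (hij : i ≠ j) (x : X) (v : Fin θ → ℤ) :
    v ∈ wordRoots G (altWord i j (mnum G R x i j)) x ↔ v ∈ planeRoots R x i j := by
  obtain ⟨hsub, hnodup, -⟩ := wordRoots_altWord R _ hij x le_rfl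
  have : (wordRoots G (altWord i j (mnum G R x i j)) x).toFinset =
      (planeRoots R x i j) := by
    refine Set.eq_of_subset_of_ncard_le (fun w hw => hsub w (by simpa using hw)) ?_
      (R.pairFinite x i j)
    rw [Set.ncard_coe_finset, List.toFinset_card_of_nodup hnodup, length_wordRoots,
      length_altWord]
    rfl
  rw [← this]
  simp

lemma wordRoots_perm {i j : Fin θ} (hij : i ≠ j) (x : X) :
    (wordRoots G (altWord i j (mnum G R x i j)) x).Perm
      (wordRoots G (altWord j i (mnum G R x i j)) x) := by
  have h := mem_wordRoots_mnum R hij x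
  have h' := mem_wordRoots_mnum R hij.symm x
  have hn := (wordRoots_altWord R _ hij x le_rfl).2.1
  have hn' := (wordRoots_altWord R _ hij.symm x le_rfl).2.1
  rw [mnum_comm R x j i] at h' hn'
  exact (List.perm_ext_iff_of_nodup hn hn').2 fun v => by rw [h, h', planeRoots_comm]

lemma wordRoots_append_singleton (l : List (Fin θ)) (c : Fin θ) (x : X) :
    ∃ v, wordRoots G (l ++ [c]) x = wordRoots G l x ++ [v] := by
  induction l generalizing x with
  | nil => exact ⟨_, rfl⟩
  | cons i l ih =>
    obtain ⟨v, hv⟩ := ih (G.ρ i x)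
    exact ⟨srefl G x i v, by simp [wordRoots, hv]⟩

lemma altWord_succ (i j : Fin θ) (n : ℕ) :
    ∃ c, altWord i j (n + 1) = altWord i j n ++ [c] := by
  induction n generalizing i j with
  | zero => exact ⟨i, rfl⟩
  | succ n ih =>
    obtain ⟨c, hc⟩ := ih j i
    exact ⟨c, by rw [altWord, hc]; rfl⟩

lemma wordRoots_last {i j : Fin θ} (hij : i ≠ j) {x : X} {n : ℕ}
    (hn : mnum G R x i j = n + 1) :
    wordRoots G (altWord i j (n + 1)) x = wordRoots G (altWord i j n) x ++ [al θ j] := by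
  obtain ⟨c, hc⟩ := altWord_succ i j n
  obtain ⟨v, hv⟩ := wordRoots_append_singleton (G := G) (altWord i j n) c x
  have hmem := (mem_wordRoots_mnum R hij x _).2 (al_mem_planeRoots' R x i j)
  rw [hn, hc, hv, List.mem_append, List.mem_singleton] at hmem
  rcases hmem with h | rfl
  · have := eq_mnum_of_al_mem_wordRoots R hij (by omega) h
    omega
  · rw [hc, hv]

end Roots

end WeylGroupoid

namespace WeylGroupoid

variable {θ : ℕ} {X : Type} [Fintype X] [DecidableEq X]

section Walks

variable {G : SCG θ X}

lemma wsrc_append (l l' : List (Fin θ)) (x : X) : wsrc G (l ++ l') x = wsrc G l' (wsrc G l x) := by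
  induction l generalizing x with
  | nil => rfl
  | cons i l ih => exact ih _

lemma ρ_injective (i : Fin θ) : Function.Injective (G.ρ i) :=
  Function.LeftInverse.injective (G.invol i)

lemma wsrc_injective (l : List (Fin θ)) : Function.Injective (wsrc G l) := by
  induction l with
  | nil => exact fun _ _ h => h
  | cons i l ih => exact fun _ _ h => ρ_injective i (ih h)

lemma wsrc_altWord_iterate (i j : Fin θ) : ∀ (m : ℕ) (y : X),
    wsrc G (altWord i j m) ((fun z => G.ρ i (G.ρ j z))^[m] y) = wsrc G (altWord j i m) y
  | 0, _ => rfl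
  | 1, y => G.invol i _
  | m + 2, y => by
    rw [Function.iterate_succ_apply', Function.iterate_succ_apply]
    simp only [altWord, wsrc, G.invol]
    exact wsrc_altWord_iterate i j m _

lemma wsrc_altWord_comm (R : GRS G) (i j : Fin θ) (x : X) :
    wsrc G (altWord i j (mnum G R x i j)) x = wsrc G (altWord j i (mnum G R x i j)) x := by
  have h := wsrc_altWord_iterate (G := G) i j (mnum G R x i j) x
  rwa [mnum, R.loop x i j] at h

lemma not_fixed_ρ {i j : Fin θ} {y : X} (h : ¬ (G.ρ i y = y ∧ G.ρ j y = y)) :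
    ¬ (G.ρ i (G.ρ j y) = G.ρ j y ∧ G.ρ j (G.ρ j y) = G.ρ j y) := by
  rintro ⟨h1, h2⟩
  have h2' := ρ_injective j h2
  rw [h2'] at h1
  exact h ⟨h1, h2'⟩

lemma wsrc_altWord_ne (n : ℕ) {i j : Fin θ} {y : X} (h : ¬ (G.ρ i y = y ∧ G.ρ j y = y))
    (hl : wsrc G (altWord i j (n + 2)) y = wsrc G (altWord i j (n + 1)) y) :
    wsrc G (altWord i j (n + 1)) y ≠ wsrc G (altWord i j n) y := by
  induction n generalizing i j y with
  | zero =>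
    simp only [altWord, wsrc] at hl ⊢
    intro h1
    rw [h1] at hl
    exact h ⟨h1, hl⟩
  | succ n ih =>
    exact ih (not_fixed_ρ (fun h' => h h'.symm)) hl

end Walks

section NilHeckeRelations

variable {G : SCG θ X} {R : GRS G} {𝕂 : Type} [CommRing 𝕂]

lemma eN_mul_self (x : X) : eN G R 𝕂 x * eN G R 𝕂 x = eN G R 𝕂 x := by
  have h := RingQuot.mkAlgHom_rel 𝕂 (nrel.idem (G := G) (R := R) (𝕂 := 𝕂) x)
  rw [map_mul] at h
  exact h

lemma nN_mul_eN (x : X) (i : Fin θ) :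
    nN G R 𝕂 x i * eN G R 𝕂 (G.ρ i x) = nN G R 𝕂 x i := by
  have h := RingQuot.mkAlgHom_rel 𝕂 (nrel.unit_right (G := G) (R := R) (𝕂 := 𝕂) x i)
  rw [map_mul] at h
  exact h

lemma eN_mul_nN (x : X) (i : Fin θ) : eN G R 𝕂 x * nN G R 𝕂 x i = nN G R 𝕂 x i := by
  have h := RingQuot.mkAlgHom_rel 𝕂 (nrel.unit_left (G := G) (R := R) (𝕂 := 𝕂) x i)
  rw [map_mul] at h
  exact h

lemma nN_mul_nN (x : X) (i : Fin θ) : nN G R 𝕂 (G.ρ i x) i * nN G R 𝕂 x i = 0 := by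
  have h := RingQuot.mkAlgHom_rel 𝕂 (nrel.nil (G := G) (R := R) (𝕂 := 𝕂) x i)
  rw [map_mul, map_zero] at h
  exact h

lemma nN_mul_nN' (x : X) (i : Fin θ) : nN G R 𝕂 x i * nN G R 𝕂 (G.ρ i x) i = 0 := by
  simpa only [G.invol] using nN_mul_nN (R := R) (𝕂 := 𝕂) (G.ρ i x) i

lemma nW_nil (x : X) : nW G R 𝕂 [] x = 1 := by
  simp only [nW, nWF]
  exact map_one _

lemma nW_cons (i : Fin θ) (l : List (Fin θ)) (x : X) :
    nW G R 𝕂 (i :: l) x = nN G R 𝕂 x i * nW G R 𝕂 l (G.ρ i x) := by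
  simp only [nW, nWF, nN]
  exact map_mul _ _ _

lemma nW_append (l l' : List (Fin θ)) (x : X) :
    nW G R 𝕂 (l ++ l') x = nW G R 𝕂 l x * nW G R 𝕂 l' (wsrc G l x) := by
  induction l generalizing x with
  | nil => rw [nW_nil, one_mul]; rfl
  | cons i l ih => rw [List.cons_append, nW_cons, ih, nW_cons, mul_assoc]; rfl

lemma nW_mul_eN {l : List (Fin θ)} (hl : l ≠ []) (x : X) :
    nW G R 𝕂 l x * eN G R 𝕂 (wsrc G l x) = nW G R 𝕂 l x := by
  induction l generalizing x with
  | nil => exact absurd rfl hl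
  | cons i l ih =>
    rcases eq_or_ne l [] with rfl | hl'
    · rw [nW_cons, nW_nil, mul_one]
      exact nN_mul_eN x i
    · rw [nW_cons, mul_assoc]
      exact congrArg _ (ih hl' _)

lemma eN_mul_nW (i : Fin θ) (l : List (Fin θ)) (x : X) :
    eN G R 𝕂 x * nW G R 𝕂 (i :: l) x = nW G R 𝕂 (i :: l) x := by
  rw [nW_cons, ← mul_assoc, eN_mul_nN]

lemma nW_braid (x : X) {i j : Fin θ} (hij : i ≠ j) :
    nW G R 𝕂 (altWord i j (mnum G R x i j)) x = nW G R 𝕂 (altWord j i (mnum G R x i j)) x :=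
  RingQuot.mkAlgHom_rel 𝕂 (nrel.braid (G := G) (R := R) (𝕂 := 𝕂) x i j hij)

end NilHeckeRelations

section Products

variable {G : SCG θ X} {R : GRS G}

lemma hGen_of_ne {x : X} {i : Fin θ} (h : G.ρ i x ≠ x) (t : MvPolynomial (Fin θ) ℤ) :
    hGen G R x i t = t • nN G R _ x i := if_neg h

lemma hGen_of_eq {x : X} {i : Fin θ} (h : G.ρ i x = x) (t : MvPolynomial (Fin θ) ℤ) :
    hGen G R x i t = eN G R _ x + t • nN G R _ x i := if_pos h

variable (G R) in
/-- The product `h_{i_1}^{x_1}(t_1) h_{i_2}^{x_2}(t_2) ⋯` with freely chosen parameters. -/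
def hProd : List (Fin θ) → List (MvPolynomial (Fin θ) ℤ) → X → NH G R (MvPolynomial (Fin θ) ℤ)
  | i :: l, t :: ts, x => hGen G R x i t * hProd l ts (G.ρ i x)
  | _, _, _ => 1

lemma hProd_append {l l' : List (Fin θ)} {ts ts' : List (MvPolynomial (Fin θ) ℤ)}
    (h : l.length = ts.length) (x : X) :
    hProd G R (l ++ l') (ts ++ ts') x = hProd G R l ts x * hProd G R l' ts' (wsrc G l x) := by
  induction l generalizing ts x with
  | nil =>
    obtain rfl := List.length_eq_zero_iff.1 h.symm
    simp [hProd, wsrc]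
  | cons i l ih =>
    cases ts with
    | nil => simp at h
    | cons t ts =>
      simp only [List.cons_append, hProd, wsrc, mul_assoc]
      rw [ih (by simpa using h)]

lemma sAct_lin (x : X) (i : Fin θ) (v : Fin θ → ℤ) : sAct G x i (lin v) = lin (srefl G x i v) := by
  have hX (k : Fin θ) : sAct G x i (MvPolynomial.X k) =
      MvPolynomial.X k - MvPolynomial.C (G.C x i k) * MvPolynomial.X i :=
    MvPolynomial.aeval_X _ k
  have hC (c : ℤ) : sAct G x i (MvPolynomial.C c) = MvPolynomial.C c :=
    MvPolynomial.aeval_C _ c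
  simp only [lin, map_sum, map_mul, hX, hC, srefl, map_sub, mul_sub, sub_mul,
    Finset.sum_sub_distrib, apply_ite (MvPolynomial.C (σ := Fin θ) (R := ℤ)), map_zero, ite_mul,
    zero_mul, Finset.sum_ite_eq', Finset.mem_univ, if_true, Finset.sum_mul]
  congr 1
  exact Finset.sum_congr rfl fun k _ => by ring

lemma lin_al (i : Fin θ) : lin (al θ i) = MvPolynomial.X i := by
  rw [lin, Finset.sum_eq_single i] <;> simp +contextual [al]

lemma hP_eq_hProd (l : List (Fin θ)) (x : X)
    (s : MvPolynomial (Fin θ) ℤ →+* MvPolynomial (Fin θ) ℤ) :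
    hP G R l x s = hProd G R l ((wordRoots G l x).map fun v => s (lin v)) x := by
  induction l generalizing x s with
  | nil => rfl
  | cons i l ih =>
    simp [hP, wordRoots, hProd, ih, lin_al, Function.comp_def, sAct_lin]

lemma nN_mul_hProd (k : ℕ) {i j : Fin θ} {y : X} (h : ¬ (G.ρ i y = y ∧ G.ρ j y = y))
    (hl : wsrc G (altWord j i (k + 1)) y ≠ wsrc G (altWord j i k) y)
    {ts : List (MvPolynomial (Fin θ) ℤ)} (hts : ts.length = k) :
    nN G R _ y j * hProd G R (altWord i j k) ts (G.ρ j y) =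
      ts.prod • nW G R _ (altWord j i (k + 1)) y := by
  induction k generalizing i j y ts with
  | zero =>
    obtain rfl := List.length_eq_zero_iff.1 hts
    simp [altWord, hProd, nW_cons, nW_nil]
  | succ k ih =>
    obtain ⟨t, ts, rfl⟩ := List.exists_cons_of_length_eq_add_one hts
    have hts' : ts.length = k := by simpa using hts
    have h' := not_fixed_ρ h
    have ih' := ih (fun h'' => h' h''.symm) hl hts'
    have main : nN G R _ y j * (t • nN G R _ (G.ρ j y) i *
        hProd G R (altWord j i k) ts (G.ρ i (G.ρ j y))) =
        (t :: ts).prod • nW G R _ (altWord j i (k + 1 + 1)) y := by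
      rw [smul_mul_assoc, ih', smul_smul, List.prod_cons, mul_smul_comm]
      exact congrArg _ (nW_cons j (altWord i j (k + 1)) y).symm
    rw [altWord, hProd]
    by_cases hi : G.ρ i (G.ρ j y) = G.ρ j y
    · rw [hGen_of_eq hi, add_mul, mul_add, main, ← mul_assoc, nN_mul_eN, hi]
      have : nN G R _ y j * hProd G R (altWord j i k) ts (G.ρ j y) = 0 := by
        cases k with
        | zero => exact absurd hi hl
        | succ k =>
          obtain ⟨t', ts, rfl⟩ := List.exists_cons_of_length_eq_add_one hts'
          rw [altWord, hProd, hGen_of_ne fun hj => h' ⟨hi, hj⟩, smul_mul_assoc, mul_smul_comm,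
            ← mul_assoc, nN_mul_nN', zero_mul, smul_zero]
      rw [this, zero_add]
    · rw [hGen_of_ne hi, main]

lemma hProd_of_ne (k : ℕ) {i j : Fin θ} {y : X} (h : G.ρ j y ≠ y)
    (hl : wsrc G (altWord j i (k + 1)) y ≠ wsrc G (altWord j i k) y)
    {ts : List (MvPolynomial (Fin θ) ℤ)} (hts : ts.length = k + 1) :
    hProd G R (altWord j i (k + 1)) ts y = ts.prod • nW G R _ (altWord j i (k + 1)) y := by
  obtain ⟨t, ts, rfl⟩ := List.exists_cons_of_length_eq_add_one hts
  nth_rw 1 [altWord]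
  rw [hProd, hGen_of_ne h, smul_mul_assoc,
    nN_mul_hProd k (fun h' => h h'.2) hl (by simpa using hts), smul_smul, List.prod_cons]

end Products

end WeylGroupoid

namespace WeylGroupoid

variable {θ : ℕ} {X : Type} [Fintype X] [DecidableEq X]

section Braid

variable {G : SCG θ X} (R : GRS G)

lemma hP_id (l : List (Fin θ)) (x : X) :
    hP G R l x (RingHom.id _) = hProd G R l ((wordRoots G l x).map lin) x := by
  rw [hP_eq_hProd]
  rfl

lemma wsrc_mnum_ne {i j : Fin θ} {x : X} {n : ℕ} (hn : mnum G R x i j = n + 1)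
    (hj : G.ρ j x ≠ x) : wsrc G (altWord i j (n + 1)) x ≠ wsrc G (altWord i j n) x := fun h => by
  have hc := wsrc_altWord_comm R i j x
  rw [hn] at hc
  exact hj (wsrc_injective (altWord i j n) (hc.symm.trans h))

lemma hP_braid_of_ne {i j : Fin θ} (hij : i ≠ j) {x : X} (hi : G.ρ i x ≠ x) (hj : G.ρ j x ≠ x) :
    hP G R (altWord i j (mnum G R x i j)) x (RingHom.id _) =
      hP G R (altWord j i (mnum G R x i j)) x (RingHom.id _) := by
  have hb := nW_braid (R := R) (𝕂 := MvPolynomial (Fin θ) ℤ) x hij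
  have hp := ((wordRoots_perm R hij x).map lin).prod_eq
  have hn' := mnum_comm R x j i
  obtain ⟨n, hn⟩ : ∃ n, mnum G R x i j = n + 1 :=
    Nat.exists_eq_add_of_le' (one_le_two.trans (two_le_mnum R x hij))
  rw [hn] at hb hp hn'
  rw [hP_id, hP_id, hn,
    hProd_of_ne n hi (wsrc_mnum_ne R hn hj) (by simp [length_wordRoots, length_altWord]),
    hProd_of_ne n hj (wsrc_mnum_ne R hn' hi) (by simp [length_wordRoots, length_altWord]), hp, hb]

lemma lin_al_ne_zero (i : Fin θ) : lin (al θ i) ≠ 0 := by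
  rw [lin_al]
  exact MvPolynomial.X_ne_zero i

lemma hP_braid_of_eq_of_ne {i j : Fin θ} (hij : i ≠ j) {x : X} (hi : G.ρ i x = x)
    (hj : G.ρ j x ≠ x) :
    hP G R (altWord i j (mnum G R x i j)) x (RingHom.id _) =
      hP G R (altWord j i (mnum G R x i j)) x (RingHom.id _) := by
  have hb := nW_braid (R := R) (𝕂 := MvPolynomial (Fin θ) ℤ) x hij
  have hp := ((wordRoots_perm R hij x).map lin).prod_eq
  have hn' := mnum_comm R x j i
  have hc := wsrc_altWord_comm R i j x
  obtain ⟨n, hn⟩ : ∃ n, mnum G R x i j = n + 2 :=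
    Nat.exists_eq_add_of_le' (two_le_mnum R x hij)
  rw [hn] at hb hp hn' hc
  rw [hP_id, hP_id, hn]
  obtain ⟨c, hcj⟩ := altWord_succ j i (n + 1)
  have hlast := wordRoots_last R hij.symm hn'
  have hloop : wsrc G (altWord j i (n + 2)) x = wsrc G (altWord j i (n + 1)) x := by
    rw [← hc, altWord, wsrc, hi]
  have hl := wsrc_altWord_ne n (fun h => hj h.1) hloop
  have hw : wordRoots G (altWord i j (n + 2)) x =
      al θ i :: (wordRoots G (altWord j i (n + 1)) x).map (srefl G x i) := by
    rw [altWord, wordRoots, hi]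
  have hL : hProd G R (altWord i j (n + 2)) ((wordRoots G (altWord i j (n + 2)) x).map lin) x =
      (((wordRoots G (altWord j i (n + 1)) x).map (srefl G x i)).map lin).prod •
        (nW G R _ (altWord j i (n + 1)) x + lin (al θ i) • nW G R _ (altWord i j (n + 2)) x) := by
    rw [hw, altWord, List.map_cons, hProd, hi, hGen_of_eq hi,
      hProd_of_ne n hj hl (by simp [length_wordRoots, length_altWord]), mul_smul_comm, add_mul,
      smul_mul_assoc, nW_cons, hi, altWord, eN_mul_nW]
  have hR : hProd G R (altWord j i (n + 2)) ((wordRoots G (altWord j i (n + 2)) x).map lin) x =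
      ((wordRoots G (altWord j i (n + 1)) x).map lin).prod •
        (nW G R _ (altWord j i (n + 1)) x + lin (al θ i) • nW G R _ (altWord j i (n + 2)) x) := by
    have hfix : G.ρ c (wsrc G (altWord j i (n + 1)) x) = wsrc G (altWord j i (n + 1)) x := by
      rw [hcj, wsrc_append] at hloop
      exact hloop
    rw [hlast, hcj, List.map_append, hProd_append (by simp [length_wordRoots]),
      hProd_of_ne n hj hl (by simp [length_wordRoots, length_altWord]), nW_append]
    simp only [List.map_cons, List.map_nil, hProd, mul_one, hGen_of_eq hfix, mul_add, nW_cons,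
      nW_nil, smul_mul_assoc, mul_smul_comm, smul_add]
    rw [nW_mul_eN (by simp [altWord]), smul_comm (lin (al θ i))]
  have hprod : (((wordRoots G (altWord j i (n + 1)) x).map (srefl G x i)).map lin).prod =
      ((wordRoots G (altWord j i (n + 1)) x).map lin).prod := by
    rw [hw, hlast, List.map_cons, List.prod_cons, List.map_append, List.prod_append, mul_comm]
      at hp
    simpa [lin_al_ne_zero] using hp
  rw [hL, hR, hprod, hb]

end Braid

section YangBaxter

variable {𝕂 A : Type*} [CommRing 𝕂] [Ring A] [Algebra 𝕂 A] {e a b : A} (p q : 𝕂)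

lemma yangBaxter_two (hee : e * e = e) (hea : e * a = a) (hae : a * e = a) (heb : e * b = b)
    (hbe : b * e = b) (h : a * b = b * a) :
    (e + p • a) * (e + q • b) = (e + q • b) * (e + p • a) := by
  simp only [add_mul, mul_add, smul_mul_assoc, mul_smul_comm, hee, hea, hae, heb, hbe, h]
  module

lemma yangBaxter_three (hee : e * e = e) (hea : e * a = a) (hae : a * e = a) (heb : e * b = b)
    (hbe : b * e = b) (haa : a * a = 0) (hbb : b * b = 0) (h : a * (b * a) = b * (a * b)) :
    (e + p • a) * ((e + (p + q) • b) * (e + q • a)) =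
      (e + q • b) * ((e + (p + q) • a) * (e + p • b)) := by
  have hea' (c : A) : e * (a * c) = a * c := by rw [← mul_assoc, hea]
  have heb' (c : A) : e * (b * c) = b * c := by rw [← mul_assoc, heb]
  simp only [add_mul, mul_add, smul_mul_assoc, mul_smul_comm, hee, hea, hae, heb, hbe, haa, hbb, hea', heb',
    smul_zero, h]
  module

lemma yangBaxter_four (hee : e * e = e) (hea : e * a = a) (hae : a * e = a) (heb : e * b = b)
    (hbe : b * e = b) (haa : a * a = 0) (hbb : b * b = 0)
    (h : a * (b * (a * b)) = b * (a * (b * a))) :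
    (e + p • a) * ((e + (2 * p + q) • b) * ((e + (p + q) • a) * (e + q • b))) =
      (e + q • b) * ((e + (p + q) • a) * ((e + (2 * p + q) • b) * (e + p • a))) := by
  have haa' (c : A) : a * (a * c) = 0 := by rw [← mul_assoc, haa, zero_mul]
  have hbb' (c : A) : b * (b * c) = 0 := by rw [← mul_assoc, hbb, zero_mul]
  have hea' (c : A) : e * (a * c) = a * c := by rw [← mul_assoc, hea]
  have heb' (c : A) : e * (b * c) = b * c := by rw [← mul_assoc, heb]
  simp only [add_mul, mul_add, smul_mul_assoc, mul_smul_comm, hee, hea, hae, heb, hbe, haa, hbb,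
    haa', hbb', hea', heb', h, smul_zero, mul_zero]
  module

lemma yangBaxter_six (hee : e * e = e) (hea : e * a = a) (hae : a * e = a) (heb : e * b = b)
    (hbe : b * e = b) (haa : a * a = 0) (hbb : b * b = 0)
    (h : a * (b * (a * (b * (a * b)))) = b * (a * (b * (a * (b * a))))) :
    (e + p • a) * ((e + (3 * p + q) • b) * ((e + (2 * p + q) • a) * ((e + (3 * p + 2 * q) • b) *
        ((e + (p + q) • a) * (e + q • b))))) =
      (e + q • b) * ((e + (p + q) • a) * ((e + (3 * p + 2 * q) • b) * ((e + (2 * p + q) • a) *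
        ((e + (3 * p + q) • b) * (e + p • a))))) := by
  have haa' (c : A) : a * (a * c) = 0 := by rw [← mul_assoc, haa, zero_mul]
  have hbb' (c : A) : b * (b * c) = 0 := by rw [← mul_assoc, hbb, zero_mul]
  have hea' (c : A) : e * (a * c) = a * c := by rw [← mul_assoc, hea]
  have heb' (c : A) : e * (b * c) = b * c := by rw [← mul_assoc, heb]
  simp only [add_mul, mul_add, smul_mul_assoc, mul_smul_comm, hee, hea, hae, heb, hbe, haa, hbb,
    haa', hbb', hea', heb', h, smul_zero, mul_zero]
  module

end YangBaxter

section RankTwo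

variable {G : SCG θ X}

lemma mem_wordRoots_of_four_le (k : ℕ) {i j : Fin θ} {x : X} (hij : i ≠ j) (hi : G.ρ i x = x)
    (hj : G.ρ j x = x) (h4 : 4 ≤ G.C x i j * G.C x j i) {v : Fin θ → ℤ}
    (hv : v ∈ wordRoots G (altWord i j k) x) :
    ∃ p q : ℤ, v = p • al θ i + q • al θ j ∧ 0 < p ∧ 0 ≤ q ∧ -G.C x i j * q ≤ 2 * p := by
  induction k generalizing i j v with
  | zero => simp [altWord, wordRoots] at hv
  | succ k ih =>
    rw [altWord, wordRoots, hi] at hv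
    rcases List.mem_cons.1 hv with rfl | hv
    · exact ⟨1, 0, by simp, by simp⟩
    · obtain ⟨w, hw, rfl⟩ := List.mem_map.1 hv
      obtain ⟨p, q, rfl, hp, hq, hpq⟩ := ih hij.symm hj hi (by linarith) hw
      have h1 := G.offdiag x i j hij
      have h2 := G.offdiag x j i hij.symm
      have h3 : 0 < -G.C x i j := by
        rcases h1.lt_or_eq with h | h
        · omega
        · rw [h] at h4
          omega
      have h5 : 2 * q ≤ -G.C x i j * p := by
        have h6 := mul_le_mul_of_nonneg_left hpq h3.le
        have h7 := mul_le_mul_of_nonneg_right h4 hq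
        linarith
      have h6 := mul_pos h3 hp
      refine ⟨-G.C x i j * p - q, p, ?_, by linarith, hp.le, by linarith⟩
      rw [srefl_add, srefl_smul, srefl_smul, srefl_al_self, srefl_al]
      module

lemma cartan_mul_lt_four (R : GRS G) {i j : Fin θ} {x : X} (hij : i ≠ j) (hi : G.ρ i x = x)
    (hj : G.ρ j x = x) : G.C x i j * G.C x j i < 4 := by
  by_contra! h4
  obtain ⟨p, q, h, hp, -⟩ := mem_wordRoots_of_four_le _ hij hi hj h4
    ((mem_wordRoots_mnum R hij x _).2 (al_mem_planeRoots' R x i j))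
  have := congrFun h i
  simp [al, hij] at this
  omega

lemma cartan_cases (R : GRS G) {i j : Fin θ} {x : X} (hij : i ≠ j) (hi : G.ρ i x = x) (hj : G.ρ j x = x) :
    (G.C x i j = 0 ∧ G.C x j i = 0) ∨ (G.C x i j = -1 ∧ G.C x j i = -1) ∨
    (G.C x i j = -1 ∧ G.C x j i = -2) ∨ (G.C x i j = -2 ∧ G.C x j i = -1) ∨
    (G.C x i j = -1 ∧ G.C x j i = -3) ∨ (G.C x i j = -3 ∧ G.C x j i = -1) := by
  have h := cartan_mul_lt_four R hij hi hj
  have h1 := G.offdiag x i j hij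
  have h2 := G.offdiag x j i hij.symm
  have h3 := G.zero_iff x i j hij
  by_cases h0 : G.C x i j = 0
  · exact Or.inl ⟨h0, h3.1 h0⟩
  · have h0' := mt h3.2 h0
    have h4 : -3 ≤ G.C x i j := by nlinarith [show G.C x j i ≤ -1 by omega]
    have h5 : -3 ≤ G.C x j i := by nlinarith [show G.C x i j ≤ -1 by omega]
    generalize G.C x i j = a at *
    generalize G.C x j i = b at *
    interval_cases a <;> interval_cases b <;> simp_all

lemma wordRoots_altWord_subset {i j : Fin θ} (x : X) {k n : ℕ} (h : k ≤ n) :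
    wordRoots G (altWord i j k) x ⊆ wordRoots G (altWord i j n) x := by
  induction n, h using Nat.le_induction with
  | base => exact List.Subset.refl _
  | succ n _ ih =>
    obtain ⟨c, hc⟩ := altWord_succ i j n
    obtain ⟨v, hv⟩ := wordRoots_append_singleton (G := G) (altWord i j n) c x
    rw [hc, hv]
    exact List.subset_append_of_subset_left _ ih

lemma mnum_eq_succ (R : GRS G) {i j : Fin θ} {x : X} (hij : i ≠ j) {n : ℕ}
    (h : al θ j ∈ wordRoots G (altWord i j (n + 1)) x)
    (hnot : al θ j ∉ wordRoots G (altWord i j n) x) : mnum G R x i j = n + 1 := by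
  rcases le_or_gt (n + 1) (mnum G R x i j) with hn | hn
  · exact (eq_mnum_of_al_mem_wordRoots R hij hn h).symm
  · exact absurd (wordRoots_altWord_subset x (Nat.le_of_lt_succ hn)
      ((mem_wordRoots_mnum R hij x _).2 (al_mem_planeRoots' R x i j))) hnot

/-- The vector `p α_i + q α_j`. -/
def comb (i j : Fin θ) (p q : ℤ) : Fin θ → ℤ := p • al θ i + q • al θ j

lemma comb_inj {i j : Fin θ} (hij : i ≠ j) {p q p' q' : ℤ} :
    comb i j p q = comb i j p' q' ↔ p = p' ∧ q = q' := by
  refine ⟨fun h => ⟨?_, ?_⟩, fun h => by rw [h.1, h.2]⟩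
  · simpa [comb, al, hij] using congrFun h i
  · simpa [comb, al, hij.symm] using congrFun h j

lemma al_left_eq_comb (i j : Fin θ) : al θ i = comb i j 1 0 := by simp [comb]

lemma al_right_eq_comb (i j : Fin θ) : al θ j = comb i j 0 1 := by simp [comb]

lemma srefl_left_comb (x : X) (i j : Fin θ) (p q : ℤ) :
    srefl G x i (comb i j p q) = comb i j (-p - G.C x i j * q) q := by
  rw [comb, comb, srefl_add, srefl_smul, srefl_smul, srefl_al_self, srefl_al]
  module

lemma srefl_right_comb (x : X) (i j : Fin θ) (p q : ℤ) :
    srefl G x j (comb i j p q) = comb i j p (-q - G.C x j i * p) := by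
  rw [comb, comb, srefl_add, srefl_smul, srefl_smul, srefl_al_self, srefl_al]
  module

lemma lin_comb (i j : Fin θ) (p q : ℤ) :
    lin (comb i j p q) = (p : MvPolynomial (Fin θ) ℤ) * MvPolynomial.X i +
      (q : MvPolynomial (Fin θ) ℤ) * MvPolynomial.X j := by
  rw [← lin_al i, ← lin_al j]
  simp only [lin, comb, Pi.add_apply, Pi.smul_apply, smul_eq_mul, map_add, map_mul, add_mul,
    Finset.sum_add_distrib, Finset.mul_sum, mul_assoc, eq_intCast]

lemma hP_braid_of_eq_of_cartan (R : GRS G) {i j : Fin θ} (hij : i ≠ j) {x : X}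
    (hi : G.ρ i x = x) (hj : G.ρ j x = x)
    (hC : (G.C x i j = 0 ∧ G.C x j i = 0) ∨ (G.C x i j = -1 ∧ G.C x j i = -1) ∨
      (G.C x i j = -2 ∧ G.C x j i = -1) ∨ (G.C x i j = -3 ∧ G.C x j i = -1)) :
    hP G R (altWord i j (mnum G R x i j)) x (RingHom.id _) =
      hP G R (altWord j i (mnum G R x i j)) x (RingHom.id _) := by
  have hb := nW_braid (R := R) (𝕂 := MvPolynomial (Fin θ) ℤ) x hij
  have hee := eN_mul_self (R := R) (𝕂 := MvPolynomial (Fin θ) ℤ) x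
  have hei := eN_mul_nN (R := R) (𝕂 := MvPolynomial (Fin θ) ℤ) x i
  have hej := eN_mul_nN (R := R) (𝕂 := MvPolynomial (Fin θ) ℤ) x j
  have hie := nN_mul_eN (R := R) (𝕂 := MvPolynomial (Fin θ) ℤ) x i
  have hje := nN_mul_eN (R := R) (𝕂 := MvPolynomial (Fin θ) ℤ) x j
  have hii := nN_mul_nN (R := R) (𝕂 := MvPolynomial (Fin θ) ℤ) x i
  have hjj := nN_mul_nN (R := R) (𝕂 := MvPolynomial (Fin θ) ℤ) x j
  rw [hi] at hie hii
  rw [hj] at hje hjj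
  rw [hP_id, hP_id]
  rcases hC with ⟨h1, h2⟩ | ⟨h1, h2⟩ | ⟨h1, h2⟩ | ⟨h1, h2⟩
  · have hm : mnum G R x i j = 1 + 1 := by
      apply mnum_eq_succ R hij <;>
        simp [altWord, wordRoots, hi, al_left_eq_comb i j, al_right_eq_comb i j,
          srefl_left_comb, h1, comb_inj hij]
    rw [hm] at hb ⊢
    have := yangBaxter_two (𝕂 := MvPolynomial (Fin θ) ℤ) (.X i) (.X j) hee hei hie hej hje
      (by simpa [altWord, nW_cons, nW_nil, hi, hj] using hb)
    simpa [altWord, wordRoots, hi, hj, al_left_eq_comb i j, al_right_eq_comb i j,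
      srefl_left_comb, srefl_right_comb, h1, h2, hProd, hGen_of_eq, lin_comb] using this
  · have hm : mnum G R x i j = 2 + 1 := by
      apply mnum_eq_succ R hij <;>
        simp [altWord, wordRoots, hi, hj, al_left_eq_comb i j, al_right_eq_comb i j,
          srefl_left_comb, srefl_right_comb, h1, h2, comb_inj hij]
    rw [hm] at hb ⊢
    have := yangBaxter_three (𝕂 := MvPolynomial (Fin θ) ℤ) (.X i) (.X j) hee hei hie hej hje hii hjj
      (by simpa [altWord, nW_cons, nW_nil, hi, hj] using hb)
    simpa [altWord, wordRoots, hi, hj, al_left_eq_comb i j, al_right_eq_comb i j,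
      srefl_left_comb, srefl_right_comb, h1, h2, hProd, hGen_of_eq, lin_comb] using this
  · have hm : mnum G R x i j = 3 + 1 := by
      apply mnum_eq_succ R hij <;>
        simp [altWord, wordRoots, hi, hj, al_left_eq_comb i j, al_right_eq_comb i j,
          srefl_left_comb, srefl_right_comb, h1, h2, comb_inj hij]
    rw [hm] at hb ⊢
    have := yangBaxter_four (𝕂 := MvPolynomial (Fin θ) ℤ) (.X i) (.X j) hee hei hie hej hje hii hjj
      (by simpa [altWord, nW_cons, nW_nil, hi, hj] using hb)
    simpa [altWord, wordRoots, hi, hj, al_left_eq_comb i j, al_right_eq_comb i j,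
      srefl_left_comb, srefl_right_comb, h1, h2, hProd, hGen_of_eq, lin_comb] using this
  · have hm : mnum G R x i j = 5 + 1 := by
      apply mnum_eq_succ R hij <;>
        simp [altWord, wordRoots, hi, hj, al_left_eq_comb i j, al_right_eq_comb i j,
          srefl_left_comb, srefl_right_comb, h1, h2, comb_inj hij]
    rw [hm] at hb ⊢
    have := yangBaxter_six (𝕂 := MvPolynomial (Fin θ) ℤ) (.X i) (.X j) hee hei hie hej hje hii hjj
      (by simpa [altWord, nW_cons, nW_nil, hi, hj] using hb)
    simpa [altWord, wordRoots, hi, hj, al_left_eq_comb i j, al_right_eq_comb i j,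
      srefl_left_comb, srefl_right_comb, h1, h2, hProd, hGen_of_eq, lin_comb] using this

lemma hP_braid_of_eq (R : GRS G) {i j : Fin θ} (hij : i ≠ j) {x : X}
    (hi : G.ρ i x = x) (hj : G.ρ j x = x) :
    hP G R (altWord i j (mnum G R x i j)) x (RingHom.id _) =
      hP G R (altWord j i (mnum G R x i j)) x (RingHom.id _) := by
  have hsymm := hP_braid_of_eq_of_cartan R hij.symm hj hi
  rw [mnum_comm R x j i] at hsymm
  rcases cartan_cases R hij hi hj with h | h | h | h | h | h
  · exact hP_braid_of_eq_of_cartan R hij hi hj (by simp [h])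
  · exact hP_braid_of_eq_of_cartan R hij hi hj (by simp [h])
  · exact (hsymm (by simp [h])).symm
  · exact hP_braid_of_eq_of_cartan R hij hi hj (by simp [h])
  · exact (hsymm (by simp [h])).symm
  · exact hP_braid_of_eq_of_cartan R hij hi hj (by simp [h])

end RankTwo

end WeylGroupoid

namespace WeylGroupoid

/-- **Proposition 4.5.** Fix `i ≠ j` and `x ∈ X`, and let `m = m^x_{ij}` (finite).
With `i_{2n} = j, i_{2n+1} = i`, `j_{2n} = i, j_{2n+1} = j`,
`x_n = ρ_{i_{n-1}} ⋯ ρ_{i_1}(x)` and `y_n = ρ_{j_{n-1}} ⋯ ρ_{j_1}(x)`, one has, in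
the nil-Hecke algebra over `𝕂 = ℤ[t_1,…,t_θ]`,
`h_{i_1}^{x_1}(t_{i_1}) h_{i_2}^{x_2}(s_{i_1}^{x_1}·t_{i_2}) ⋯
   h_{i_m}^{x_m}(s_{i_1}^{x_1}⋯s_{i_{m-1}}·t_{i_m})
 = h_{j_1}^{y_1}(t_{j_1}) h_{j_2}^{y_2}(s_{j_1}^{y_1}·t_{j_2}) ⋯
   h_{j_m}^{y_m}(s_{j_1}^{y_1}⋯s_{j_{m-1}}·t_{j_m})`. -/
theorem hP_braid {θ : ℕ} {X : Type} [Fintype X] [DecidableEq X]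
    (G : SCG θ X) (R : GRS G)
    (i j : Fin θ) (hij : i ≠ j) (x : X) (m : ℕ) (hm : m = mnum G R x i j) :
    hP G R (altWord i j m) x (RingHom.id _) =
      hP G R (altWord j i m) x (RingHom.id _) := by
  subst hm
  by_cases hi : G.ρ i x = x <;> by_cases hj : G.ρ j x = x
  · exact hP_braid_of_eq R hij hi hj
  · exact hP_braid_of_eq_of_ne R hij hi hj
  · rw [mnum_comm]
    exact (hP_braid_of_eq_of_ne R hij.symm hj hi).symm
  · exact hP_braid_of_ne R hij hi hj

end WeylGroupoid
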